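/- arXiv:1803.09289 — 2 statements merged into one kernel-verified Lean document; each statement's English description precedes it below -/
import Mathlib

section
/- Let f be a minmax monotone cost function on a finite tree T_in and let T = (V,E) be a subtree of T_in. Let v_1, v_2, …, v_t be the vertices, in order, of a simple path in T. Then the sequence i ↦ f(V_{-v_{i+1}}(v_i) ∪ {v_{i+1}}, v_{i+1}), for i = 1, …, t−1, is non-decreasing: for all 1 ≤ i ≤ j ≤ t−1, f(V_{-v_{i+1}}(v_i) ∪ {v_{i+1}}, v_{i+1}) ≤ f(V_{-v_{j+1}}(v_j) ∪ {v_{j+1}}, v_{j+1}). -/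
open SimpleGraph Set
open scoped ENNReal

variable {V : Type*}

/-- The vertex set of the connected component of the subgraph of `G` induced on `A`
containing the vertex `u` (empty if `u ∉ A`). -/
def reachSet (G : SimpleGraph V) (A : Set V) (u : V) : Set V :=
  {y | ∃ (hu : u ∈ A) (hy : y ∈ A), (G.induce A).Reachable ⟨u, hu⟩ ⟨y, hy⟩}

/-- `U` is a subtree: the induced subgraph on `U` is connected. -/
def IsSubtree (G : SimpleGraph V) (U : Set V) : Prop :=
  (G.induce U).Connected

/-- A minmax monotone cost function on the tree `G`:
`f {s} s = 0`; `f U s = ∞` if `U` is not a subtree or `s ∉ U`; set monotonicity;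
path monotonicity; and max tree composition (the slices of `U` defined by `s` being the
connected components of `U \ {s}`). -/
structure IsMinmaxMonotone (G : SimpleGraph V) (f : Set V → V → ℝ≥0∞) : Prop where
  singleton_eq_zero : ∀ s : V, f {s} s = 0
  eq_top_of_not_subtree : ∀ (U : Set V) (s : V), ¬ IsSubtree G U → f U s = ⊤
  eq_top_of_not_mem : ∀ (U : Set V) (s : V), s ∉ U → f U s = ⊤
  set_mono : ∀ (U₁ U₂ : Set V) (s : V), IsSubtree G U₁ → IsSubtree G U₂ →
    s ∈ U₁ → U₁ ⊆ U₂ → f U₁ s ≤ f U₂ s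
  path_mono : ∀ (U : Set V) (s u : V), IsSubtree G U → s ∉ U → u ∈ U → G.Adj s u →
    f U u ≤ f (U ∪ {s}) s
  max_comp : ∀ (U : Set V) (s : V), IsSubtree G U → s ∈ U →
    f U s = ⨆ x ∈ U \ {s}, f (reachSet G (U \ {s}) x ∪ {s}) s

/-- `s` is a leaf of the (working) tree induced on `W`. -/
def IsLeafOf (G : SimpleGraph V) (W : Set V) (s : V) : Prop :=
  s ∈ W ∧ ∃! u, u ∈ W ∧ G.Adj s u

/-- The ordered pair `(u,v)` satisfies the peaking criterion in the working tree on `W`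
with sink set `S` and threshold `𝒯`. -/
def PeakingPair (G : SimpleGraph V) (f : Set V → V → ℝ≥0∞) (𝒯 : ℝ≥0∞)
    (W S : Set V) (u v : V) : Prop :=
  u ∈ W ∧ v ∈ W ∧ G.Adj u v ∧ S ∩ reachSet G (W \ {v}) u = ∅ ∧
    f (reachSet G (W \ {v}) u) u ≤ 𝒯 ∧ 𝒯 < f (reachSet G (W \ {v}) u ∪ {v}) v

/-- `w` lies on the unique path from `a` to `b` in the tree induced on `W`. -/
def OnPath (G : SimpleGraph V) (W : Set V) (a b w : V) : Prop :=
  a ∈ W ∧ b ∈ W ∧ w ∈ W ∧ b ∉ reachSet G (W \ {w}) a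

/-- Vertices of the hub tree: union of the paths from the sinks to the root `r`. -/
def hubVerts (G : SimpleGraph V) (W S : Set V) (r : V) : Set V :=
  {w | ∃ s ∈ S, OnPath G W s r w}

/-- `r` is a valid root: a non-sink vertex of the working tree such that at least two of
the subtrees hanging off it contain sinks. -/
def GoodRoot (G : SimpleGraph V) (W S : Set V) (r : V) : Prop :=
  r ∈ W ∧ r ∉ S ∧
    ∃ η₁ η₂ : V, η₁ ≠ η₂ ∧ η₁ ∈ W ∧ η₂ ∈ W ∧ G.Adj r η₁ ∧ G.Adj r η₂ ∧
      (S ∩ reachSet G (W \ {r}) η₁).Nonempty ∧ (S ∩ reachSet G (W \ {r}) η₂).Nonempty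

/-- The working tree on `W` is RC-viable w.r.t. sinks `S` and root `r`: every outstanding
branch, together with the hub-tree node it is attached to, has cost at most `𝒯`. -/
def RCViable (G : SimpleGraph V) (f : Set V → V → ℝ≥0∞) (𝒯 : ℝ≥0∞)
    (W S : Set V) (r : V) : Prop :=
  ∀ w ∈ hubVerts G W S r, ∀ η ∈ W, G.Adj w η → η ∉ hubVerts G W S r →
    f (reachSet G (W \ {w}) η ∪ {w}) w ≤ 𝒯

/-- The set `A` is self-sufficient: it can be partitioned into subtree blocks, one for
each sink in `S ∩ A`, each block containing its sink and having cost at most `𝒯`. -/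
def SelfSufficient (G : SimpleGraph V) (f : Set V → V → ℝ≥0∞) (𝒯 : ℝ≥0∞)
    (S A : Set V) : Prop :=
  ∃ P : V → Set V,
    (⋃ s ∈ S ∩ A, P s) = A ∧
    (∀ s ∈ S ∩ A, IsSubtree G (P s) ∧ s ∈ P s ∧ f (P s) s ≤ 𝒯) ∧
    (S ∩ A).Pairwise fun s t => Disjoint (P s) (P t)

/-- The vertices of the path `Π(a,b)` in the tree induced on `W`. -/
def pathSet (G : SimpleGraph V) (W : Set V) (a b : V) : Set V :=
  {w | OnPath G W a b w}

/-- All vertices of outstanding branches attached to `w` (given hub-tree vertices `Hub`). -/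
def branchesAt (G : SimpleGraph V) (W Hub : Set V) (w : V) : Set V :=
  ⋃ η ∈ {η : V | η ∈ W ∧ G.Adj w η ∧ η ∉ Hub}, reachSet G (W \ {w}) η

/-- The bulk path `BP(a,b)`: the path `Π(a,b)` together with all outstanding branches
attached to its vertices. -/
def bulkPath (G : SimpleGraph V) (W S : Set V) (r a b : V) : Set V :=
  pathSet G W a b ∪ ⋃ w ∈ pathSet G W a b, branchesAt G W (hubVerts G W S r) w

/-- `v` is the parent of `u` in the hub tree rooted at `r`. -/
def HubParent (G : SimpleGraph V) (W S : Set V) (r u v : V) : Prop :=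
  u ∈ hubVerts G W S r ∧ v ∈ hubVerts G W S r ∧ G.Adj u v ∧ OnPath G W u r v

/-- The ordered pair `(u,v)` satisfies the reaching criterion: `v` is the hub-tree parent
of `u`, `T₋ᵥ(u)` is self-sufficient, and `BP(v,v) ∪ V₋ᵥ(u)` is not self-sufficient. -/
def ReachingPair (G : SimpleGraph V) (f : Set V → V → ℝ≥0∞) (𝒯 : ℝ≥0∞)
    (W S : Set V) (r u v : V) : Prop :=
  HubParent G W S r u v ∧
  SelfSufficient G f 𝒯 S (reachSet G (W \ {v}) u) ∧
  ¬ SelfSufficient G f 𝒯 S (bulkPath G W S r v v ∪ reachSet G (W \ {v}) u)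

/-- The vertex set `V(v)` of the subtree of the working tree (rooted at `r`) rooted at `v`:
all vertices whose path to the root passes through `v`. -/
def rootedBelow (G : SimpleGraph V) (W : Set V) (r v : V) : Set V :=
  {x | OnPath G W x r v}

/-- The rooted subtree `T(v)` is RC-viable: every outstanding branch attached to a
hub-tree node lying in `T(v)` has, together with its attachment node, cost at most `𝒯`. -/
def RCViableBelow (G : SimpleGraph V) (f : Set V → V → ℝ≥0∞) (𝒯 : ℝ≥0∞)
    (W S : Set V) (r v : V) : Prop :=
  ∀ w ∈ hubVerts G W S r ∩ rootedBelow G W r v, ∀ η ∈ W, G.Adj w η →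
    η ∉ hubVerts G W S r → f (reachSet G (W \ {w}) η ∪ {w}) w ≤ 𝒯

/-- The subtree with vertex set `A` (of the working tree rooted at `r`) is recursively
self-sufficient: for every hub-tree node `w` in `A`, the part of `A` lying below `w`
is self-sufficient. -/
def RecursivelySelfSufficientOn (G : SimpleGraph V) (f : Set V → V → ℝ≥0∞) (𝒯 : ℝ≥0∞)
    (W S : Set V) (r : V) (A : Set V) : Prop :=
  ∀ w ∈ hubVerts G W S r ∩ A, SelfSufficient G f 𝒯 S (rootedBelow G W r w ∩ A)

/-- A feasible sink configuration: a partition of all of `V_in` into subtree blocks,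
one per sink, each block containing exactly its own sink and having cost at most `𝒯`. -/
def IsFeasibleConfig (G : SimpleGraph V) (f : Set V → V → ℝ≥0∞) (𝒯 : ℝ≥0∞)
    (St : Set V) (P : V → Set V) : Prop :=
  (⋃ s ∈ St, P s) = Set.univ ∧
  St.Pairwise (fun s t => Disjoint (P s) (P t)) ∧
  ∀ s ∈ St, IsSubtree G (P s) ∧ St ∩ P s = {s} ∧ f (P s) s ≤ 𝒯

/-- An optimal feasible sink configuration: one with the minimum number of sinks. -/
def IsOptimalConfig (G : SimpleGraph V) (f : Set V → V → ℝ≥0∞) (𝒯 : ℝ≥0∞)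
    (St : Set V) (P : V → Set V) : Prop :=
  IsFeasibleConfig G f 𝒯 St P ∧
  ∀ (St' : Set V) (P' : V → Set V), IsFeasibleConfig G f 𝒯 St' P' → St.ncard ≤ St'.ncard

/-- A partial sink configuration relative to the working tree on `W`: pairwise disjoint
subtree blocks of cost at most `𝒯`, one per sink of `Sout`, covering `V_in \ (W \ Sout)`. -/
def IsPartialConfig (G : SimpleGraph V) (f : Set V → V → ℝ≥0∞) (𝒯 : ℝ≥0∞)
    (W : Set V) (Sout : Set V) (P : V → Set V) : Prop :=
  Sout.Pairwise (fun s t => Disjoint (P s) (P t)) ∧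
  (∀ s ∈ Sout, IsSubtree G (P s) ∧ s ∈ P s ∧ f (P s) s ≤ 𝒯) ∧
  (⋃ s ∈ Sout, P s) = Set.univ \ (W \ Sout)

/-- `(St, Pt)` is an optimal feasible sink configuration witnessing the optimality of the
partial configuration `(Sout, P)` relative to the working tree on `W` (conditions (C1)-(C3)). -/
def WitnessesOptimality (G : SimpleGraph V) (f : Set V → V → ℝ≥0∞) (𝒯 : ℝ≥0∞)
    (W : Set V) (Sout : Set V) (P : V → Set V) (St : Set V) (Pt : V → Set V) : Prop :=
  IsOptimalConfig G f 𝒯 St Pt ∧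
  Sout ⊆ St ∧
  St \ W = Sout \ W ∧
  (∀ s ∈ Sout ∩ W, IsLeafOf G W s) ∧
  (∀ s ∈ St, s ∉ W → Pt s = P s ∧ Pt s ∩ W = ∅) ∧
  (∀ s ∈ Sout ∩ W, P s ⊆ Pt s ∧ Pt s \ P s ⊆ W) ∧
  (∀ s ∈ St, s ∉ Sout → Pt s ⊆ W)

/-- The partial sink configuration `(Sout, P)` is optimal relative to the working tree on `W`. -/
def OptimalRelative (G : SimpleGraph V) (f : Set V → V → ℝ≥0∞) (𝒯 : ℝ≥0∞)
    (W : Set V) (Sout : Set V) (P : V → Set V) : Prop :=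
  ∃ (St : Set V) (Pt : V → Set V), WitnessesOptimality G f 𝒯 W Sout P St Pt

/-- A vertex reachable inside `A` is reached by a walk staying in the component. -/
lemma exists_walk_of_mem_reachSet (G : SimpleGraph V) {A : Set V} {u y : V}
    (h : y ∈ reachSet G A u) : ∃ w : G.Walk u y, ∀ x ∈ w.support, x ∈ A := by
  obtain ⟨hu, hy, ⟨w⟩⟩ := h
  refine ⟨w.map (Embedding.induce A).toHom, fun x hx => ?_⟩
  obtain ⟨z, -, rfl⟩ :=
    List.mem_map.1 ((w.support_map (Embedding.induce A).toHom) ▸ hx :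
      x ∈ w.support.map (Embedding.induce A).toHom)
  exact z.2

lemma reachSet_subset (G : SimpleGraph V) (A : Set V) (u : V) : reachSet G A u ⊆ A :=
  fun _ h => h.2.1

lemma mem_reachSet_self (G : SimpleGraph V) {A : Set V} {u : V} (hu : u ∈ A) :
    u ∈ reachSet G A u :=
  ⟨hu, hu, Reachable.refl _⟩

lemma IsSubtree.subset_reachSet {G : SimpleGraph V} {S A : Set V} {u : V}
    (hS : IsSubtree G S) (hu : u ∈ S) (hSA : S ⊆ A) : S ⊆ reachSet G A u := fun y hy =>
  ⟨hSA hu, hSA hy, (hS.preconnected ⟨u, hu⟩ ⟨y, hy⟩).map (induceHomOfLE G hSA).toHom⟩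

lemma isSubtree_reachSet (G : SimpleGraph V) {A : Set V} {u : V} (hu : u ∈ A) :
    IsSubtree G (reachSet G A u) := by
  refine induce_connected_of_patches u (mem_reachSet_self G hu) fun {v} hv => ?_
  obtain ⟨w, hw⟩ := exists_walk_of_mem_reachSet G hv
  have hc : IsSubtree G {x | x ∈ w.support} := w.connected_induce_support
  exact ⟨{x | x ∈ w.support}, hc.subset_reachSet w.start_mem_support hw,
    w.start_mem_support, w.end_mem_support, hc.preconnected _ _⟩

lemma IsSubtree.union_singleton {G : SimpleGraph V} {S : Set V} {u v : V}
    (hS : IsSubtree G S) (hu : u ∈ S) (h : G.Adj u v) : IsSubtree G (S ∪ {v}) := by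
  have : (G.induce {v}).Preconnected := fun x y => by rw [Subsingleton.elim x y]
  exact connected_induce_union hS.preconnected this hu rfl h

/-- In an acyclic graph, removing `b` separates any two distinct neighbours of `b`. -/
lemma notMem_reachSet_of_adj_of_adj {G : SimpleGraph V} (hG : G.IsAcyclic) {A : Set V}
    {a b c : V} (hab : G.Adj a b) (hbc : G.Adj b c) (hac : a ≠ c) :
    c ∉ reachSet G (A \ {b}) a := by
  classical
  intro h
  obtain ⟨w, hw⟩ := exists_walk_of_mem_reachSet G h
  have hp : (Walk.cons hab (Walk.cons hbc Walk.nil)).IsPath := by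
    simp [Walk.cons_isPath_iff, hab.ne, hbc.ne, hac]
  have heq := (hG.subsingleton_path a c).elim ⟨_, hp⟩ w.toPath
  have hb : b ∈ (w.toPath : G.Walk a c).support := by
    rw [← heq]
    simp
  exact (hw b (w.support_toPath_subset_support hb)).2 rfl

/-- The cost of a branch together with its attachment vertex does not decrease when moving
one edge further along a simple path. -/
lemma IsMinmaxMonotone.cost_le_cost_of_adj_of_adj {G : SimpleGraph V} (hG : G.IsAcyclic)
    {f : Set V → V → ℝ≥0∞} (hf : IsMinmaxMonotone G f) {W : Set V} {a b c : V}
    (ha : a ∈ W) (hb : b ∈ W) (hab : G.Adj a b) (hbc : G.Adj b c) (hac : a ≠ c) :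
    f (reachSet G (W \ {b}) a ∪ {b}) b ≤ f (reachSet G (W \ {c}) b ∪ {c}) c := by
  have haW : a ∈ W \ {b} := ⟨ha, hab.ne⟩
  have hbW : b ∈ W \ {c} := ⟨hb, hbc.ne⟩
  have hA : IsSubtree G (reachSet G (W \ {b}) a ∪ {b}) :=
    (isSubtree_reachSet G haW).union_singleton (mem_reachSet_self G haW) hab
  have hU := isSubtree_reachSet G hbW
  have hsub : reachSet G (W \ {b}) a ∪ {b} ⊆ W \ {c} := by
    rintro x (hx | rfl)
    · refine ⟨(reachSet_subset G _ _ hx).1, ?_⟩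
      rintro rfl
      exact notMem_reachSet_of_adj_of_adj hG hab hbc hac hx
    · exact hbW
  have hbA : b ∈ reachSet G (W \ {b}) a ∪ {b} := Or.inr rfl
  calc f (reachSet G (W \ {b}) a ∪ {b}) b ≤ f (reachSet G (W \ {c}) b) b :=
        hf.set_mono _ _ _ hA hU hbA (hA.subset_reachSet hbA hsub)
    _ ≤ f (reachSet G (W \ {c}) b ∪ {c}) c :=
        hf.path_mono _ _ _ hU (fun h => (reachSet_subset G _ _ h).2 rfl)
          (mem_reachSet_self G hbW) hbc.symm

/-- along a simple path `p 1, p 2, …, p t` in the working tree, the costs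
`f(V₋ₚ₍ᵢ₊₁₎(p i) ∪ {p (i+1)}, p (i+1))` form a non-decreasing sequence. -/
theorem statement_12 [Fintype V] (G : SimpleGraph V) (hG : G.IsTree)
    (f : Set V → V → ℝ≥0∞) (hf : IsMinmaxMonotone G f)
    (W : Set V) (hW : IsSubtree G W)
    (t : ℕ) (p : ℕ → V)
    (hmem : ∀ i, 1 ≤ i → i ≤ t → p i ∈ W)
    (hadj : ∀ i, 1 ≤ i → i + 1 ≤ t → G.Adj (p i) (p (i + 1)))
    (hinj : ∀ i j, 1 ≤ i → i ≤ t → 1 ≤ j → j ≤ t → p i = p j → i = j) :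
    ∀ i j, 1 ≤ i → i ≤ j → j + 1 ≤ t →
      f (reachSet G (W \ {p (i + 1)}) (p i) ∪ {p (i + 1)}) (p (i + 1)) ≤
        f (reachSet G (W \ {p (j + 1)}) (p j) ∪ {p (j + 1)}) (p (j + 1)) := by
  intro i j hi hij
  induction j, hij using Nat.le_induction with
  | base => exact fun _ => le_rfl
  | succ j hij ih =>
    intro hj
    refine (ih (by lia)).trans (hf.cost_le_cost_of_adj_of_adj hG.isAcyclic
      (hmem _ (by lia) (by lia)) (hmem _ (by lia) (by lia))
      (hadj _ (by lia) (by lia)) (hadj _ (by lia) (by lia)) fun h => ?_)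
    have := hinj _ _ (by lia) (by lia) (by lia) (by lia) h
    lia
end

section
/- Let f be a minmax monotone cost function on a finite tree T_in, 𝒯 ≥ 0, and let T = (V,E) be a rooted working subtree with sink set S, hub tree T_{H(S)} rooted at r, and suppose T is RC-viable with respect to S. Suppose the ordered pair (u,v) satisfies the reaching criterion, and let T̄ = (V̄, Ē) be the working tree obtained from T by removing V_{-v}(u), with sink set S̄ = S \ V_{-v}(u). Let h = v if v is a hub of T_{H(S)} and otherwise let h be the lowest hub of T_{H(S)} on the path from the parent of v to r. Suppose h ≠ v, let v' be the child of h whose subtree contains v, and suppose f(V̄_{-h}(v') ∪ {h}, h) > 𝒯. Then there exists an edge (u', p(u')) on the path Π(v,h) that satisfies the peaking criterion in T̄ with respect to S̄, and it is the unique edge of T̄ satisfying the peaking criterion. -/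
open SimpleGraph Set
open scoped ENNReal

variable {V : Type*}

/-- `w` is a hub: the lowest common ancestor (w.r.t. root `r`) of a pair of distinct sinks. -/
def IsHub (G : SimpleGraph V) (W S : Set V) (r w : V) : Prop :=
  ∃ s₁ ∈ S, ∃ s₂ ∈ S, s₁ ≠ s₂ ∧
    OnPath G W s₁ r w ∧ OnPath G W s₂ r w ∧ OnPath G W s₁ s₂ w

section Reach

variable {G : SimpleGraph V} {A U : Set V} {a x y : V}

lemma mem_reachSet_self_s18 (ha : a ∈ A) : a ∈ reachSet G A a :=
  ⟨ha, ha, Reachable.refl _⟩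

lemma reachSet_subset_s18 : reachSet G A a ⊆ A := fun _ ⟨_, hy, _⟩ => hy

lemma mem_reachSet_of_adj (hx : x ∈ reachSet G A a) (hy : y ∈ A) (hxy : G.Adj x y) :
    y ∈ reachSet G A a := by
  obtain ⟨ha, hx, hr⟩ := hx
  refine ⟨ha, hy, hr.trans (Adj.reachable ?_)⟩
  simpa using hxy

lemma reachSet_induction {X : Set V} (ha : a ∈ X)
    (hcl : ∀ x ∈ X, x ∈ A → ∀ y ∈ A, G.Adj x y → y ∈ X) : reachSet G A a ⊆ X := by
  rintro y ⟨hu, hy, ⟨p⟩⟩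
  have key : ∀ (s t : A), (G.induce A).Walk s t → (s : V) ∈ X → (t : V) ∈ X := by
    intro s t p
    induction p with
    | nil => exact id
    | cons h _ ih => exact fun hs => ih (hcl _ hs (Subtype.prop _) _ (Subtype.prop _) h)
  exact key _ _ p ha

lemma reachSet_eq_of_mem (hx : x ∈ reachSet G A a) : reachSet G A x = reachSet G A a := by
  obtain ⟨ha, hx, hr⟩ := hx
  ext y
  exact ⟨fun ⟨_, hy, h⟩ => ⟨ha, hy, hr.trans h⟩, fun ⟨_, hy, h⟩ => ⟨hx, hy, hr.symm.trans h⟩⟩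

lemma isSubtree_of_subset_reachSet (ha : a ∈ U) (h : U ⊆ reachSet G U a) : IsSubtree G U := by
  have : Nonempty U := ⟨⟨a, ha⟩⟩
  refine ⟨fun x y => ?_⟩
  obtain ⟨_, _, hx⟩ := h x.2
  obtain ⟨_, _, hy⟩ := h y.2
  exact hx.symm.trans hy

lemma IsSubtree.subset_reachSet_s18 (hU : IsSubtree G U) (ha : a ∈ U) : U ⊆ reachSet G U a :=
  fun _ hy => ⟨ha, hy, hU.preconnected _ _⟩

lemma IsSubtree.subset_of_closed {X : Set V} (hU : IsSubtree G U) (haU : a ∈ U) (ha : a ∈ X)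
    (hcl : ∀ x ∈ X, x ∈ U → ∀ y ∈ U, G.Adj x y → y ∈ X) : U ⊆ X :=
  (hU.subset_reachSet_s18 haU).trans (reachSet_induction ha hcl)

lemma isSubtree_reachSet_s18 (ha : a ∈ A) : IsSubtree G (reachSet G A a) := by
  refine isSubtree_of_subset_reachSet (mem_reachSet_self_s18 ha) ?_
  refine reachSet_induction (X := reachSet G (reachSet G A a) a)
    (mem_reachSet_self_s18 (mem_reachSet_self_s18 ha)) fun x hx _ y hy hxy => ?_
  exact mem_reachSet_of_adj hx (mem_reachSet_of_adj (reachSet_subset_s18 hx) hy hxy) hxy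

lemma IsSubtree.union_singleton_s18 (hU : IsSubtree G U) (hx : x ∈ U) (hxy : G.Adj x y) :
    IsSubtree G (U ∪ {y}) := by
  refine isSubtree_of_subset_reachSet (a := x) (Or.inl hx) ?_
  have hsub : U ⊆ reachSet G (U ∪ {y}) x :=
    hU.subset_of_closed hx (mem_reachSet_self_s18 (Or.inl hx))
      fun z hz _ w hw hzw => mem_reachSet_of_adj hz (Or.inl hw) hzw
  rintro z (hz | rfl)
  · exact hsub hz
  · exact mem_reachSet_of_adj (hsub hx) (Or.inr rfl) hxy

end Reach

/-- The vertices on the `a`-side of the edge `ab`. -/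
def side (G : SimpleGraph V) (a b : V) : Set V := reachSet G {b}ᶜ a

section Side

variable {G : SimpleGraph V} {W : Set V} {a b c d x y z : V}

lemma left_mem_side (hab : G.Adj a b) : a ∈ side G a b := mem_reachSet_self_s18 hab.ne

lemma right_notMem_side : b ∉ side G a b := fun h => reachSet_subset_s18 h rfl

lemma mem_side_of_adj (hx : x ∈ side G a b) (hxy : G.Adj x y) (hy : y ≠ b) : y ∈ side G a b :=
  mem_reachSet_of_adj hx hy hxy

lemma eq_left_of_mem_side_of_adj (hG : G.IsTree) (hab : G.Adj a b) (hx : x ∈ side G a b)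
    (hxb : G.Adj x b) : x = a := by
  by_contra hne
  have hbr := isAcyclic_iff_forall_adj_isBridge.1 hG.isAcyclic hab
  rw [isBridge_iff] at hbr
  have hreach : side G a b ⊆ {y | (G.deleteEdges {s(a, b)}).Reachable a y} := by
    refine reachSet_induction (Reachable.refl _) fun p hp hpb q hqb hpq => ?_
    refine Reachable.trans hp (Adj.reachable ?_)
    rw [deleteEdges_adj]
    refine ⟨hpq, ?_⟩
    simp only [mem_singleton_iff, Sym2.eq_iff, not_or, not_and]
    exact ⟨fun _ => hqb, fun h => absurd h hpb⟩
  refine hbr (Reachable.trans (hreach hx) (Adj.reachable ?_))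
  rw [deleteEdges_adj]
  refine ⟨hxb, ?_⟩
  simp [hne, hab.ne']

lemma notMem_side_swap (hG : G.IsTree) (hab : G.Adj a b) (hx : x ∈ side G a b) :
    x ∉ side G b a := by
  intro hx'
  have : side G b a ⊆ (side G a b)ᶜ := by
    refine reachSet_induction right_notMem_side fun p hp _ q hqa hpq hq => ?_
    have hpb : p = b := by
      by_contra hpb
      exact hp (mem_side_of_adj hq hpq.symm hpb)
    subst hpb
    exact hqa (eq_left_of_mem_side_of_adj hG hab hq hpq.symm)
  exact this hx' hx

lemma mem_side_swap (hG : G.IsTree) (hab : G.Adj a b) (hx : x ∉ side G a b) : x ∈ side G b a := by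
  obtain ⟨p⟩ := hG.connected.preconnected a x
  have key : ∀ (s t : V), G.Walk s t → s ∈ side G a b ∪ side G b a →
      t ∈ side G a b ∪ side G b a := by
    intro s t p
    induction p with
    | nil => exact id
    | @cons s t _ h _ ih =>
      refine fun hs => ih ?_
      rcases hs with hs | hs
      · by_cases htb : t = b
        · subst htb
          exact Or.inr (left_mem_side hab.symm)
        · exact Or.inl (mem_side_of_adj hs h htb)
      · by_cases hta : t = a
        · subst hta
          exact Or.inl (left_mem_side hab)
        · exact Or.inr (mem_side_of_adj hs h hta)
  exact (key _ _ p (Or.inl (left_mem_side hab))).resolve_left hx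

lemma side_subset_side (hx : x ∈ side G a b) (hx' : x ∈ side G c d) (hd : d ∉ side G a b) :
    side G a b ⊆ side G c d := by
  have : side G a b ⊆ side G a b ∩ side G c d := by
    have heq : side G a b = reachSet G {b}ᶜ x := (reachSet_eq_of_mem hx).symm
    refine heq.subset.trans (reachSet_induction ⟨hx, hx'⟩ fun p hp _ q hqb hpq => ?_)
    have hq := mem_side_of_adj hp.1 hpq hqb
    exact ⟨hq, mem_side_of_adj hp.2 hpq fun h => hd (h ▸ hq)⟩
  exact fun z hz => (this hz).2

lemma eq_of_mem_side_of_mem_side (hG : G.IsTree) (hab : G.Adj a b) (hcb : G.Adj c b)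
    (hx : x ∈ side G a b) (hx' : x ∈ side G c b) : a = c :=
  eq_left_of_mem_side_of_adj hG hcb
    (side_subset_side hx hx' right_notMem_side (left_mem_side hab)) hab

lemma side_subset_side_of_adj (hG : G.IsTree) (hab : G.Adj a b) (hbc : G.Adj b c) (hac : a ≠ c) :
    side G a b ⊆ side G b c := by
  refine side_subset_side (left_mem_side hab)
    (mem_side_of_adj (left_mem_side hbc) hab.symm hac) fun h => ?_
  exact hac (eq_left_of_mem_side_of_adj hG hab h hbc.symm).symm

lemma IsSubtree.exists_adj_mem_side (hW : IsSubtree G W) (hb : b ∈ W) (hx : x ∈ W) (hxb : x ≠ b) :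
    ∃ a ∈ W, G.Adj a b ∧ x ∈ side G a b := by
  have : W ⊆ {z | z = b ∨ ∃ a ∈ W, G.Adj a b ∧ z ∈ side G a b} := by
    refine hW.subset_of_closed hb (Or.inl rfl) fun p hp hpW q hqW hpq => ?_
    by_cases hqb : q = b
    · exact Or.inl hqb
    rcases hp with rfl | ⟨a, haW, hab, hpa⟩
    · exact Or.inr ⟨q, hqW, hpq.symm, left_mem_side hpq.symm⟩
    · exact Or.inr ⟨a, haW, hab, mem_side_of_adj hpa hpq hqb⟩
  exact (this hx).resolve_left hxb

lemma IsSubtree.left_mem (hG : G.IsTree) (hW : IsSubtree G W) (hab : G.Adj a b) (hx : x ∈ W)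
    (hxs : x ∈ side G a b) (hy : y ∈ W) (hys : y ∉ side G a b) : a ∈ W := by
  by_contra ha
  refine hys (hW.subset_of_closed hx hxs (fun p hp hpW q hqW hpq => ?_) hy)
  refine mem_side_of_adj hp hpq fun hqb => ?_
  subst hqb
  exact ha (eq_left_of_mem_side_of_adj hG hab hp hpq ▸ hpW)

lemma IsSubtree.reachSet_diff (hG : G.IsTree) (hW : IsSubtree G W) (ha : a ∈ W)
    (hab : G.Adj a b) : reachSet G (W \ {b}) a = W ∩ side G a b := by
  refine Subset.antisymm (reachSet_induction ⟨ha, left_mem_side hab⟩ ?_) ?_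
  · exact fun p hp _ q hq hpq => ⟨hq.1, mem_side_of_adj hp.2 hpq hq.2⟩
  · have haR : a ∈ reachSet G (W \ {b}) a := mem_reachSet_self_s18 ⟨ha, hab.ne⟩
    have : W ⊆ {z | z ∈ side G a b → z ∈ reachSet G (W \ {b}) a} := by
      refine hW.subset_of_closed ha (fun _ => haR) fun p hp hpW q hqW hpq hq => ?_
      have hqb : q ≠ b := fun h => right_notMem_side (h ▸ hq)
      by_cases hpb : p = b
      · subst hpb
        rw [eq_left_of_mem_side_of_adj hG hab hq hpq.symm]
        exact haR
      · exact mem_reachSet_of_adj (hp (mem_side_of_adj hq hpq.symm hpb)) ⟨hqW, hqb⟩ hpq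
    exact fun z hz => this hz.1 hz.2

lemma IsSubtree.inter_side (hG : G.IsTree) (hW : IsSubtree G W) (ha : a ∈ W)
    (hab : G.Adj a b) : IsSubtree G (W ∩ side G a b) :=
  hW.reachSet_diff hG ha hab ▸ isSubtree_reachSet_s18 ⟨ha, hab.ne⟩

lemma IsSubtree.onPath_iff (hG : G.IsTree) (hW : IsSubtree G W) :
    OnPath G W x y z ↔ x ∈ W ∧ y ∈ W ∧ z ∈ W ∧
      ∀ a, G.Adj a z → x ∈ side G a z → y ∉ side G a z := by
  constructor
  · rintro ⟨hx, hy, hz, h⟩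
    refine ⟨hx, hy, hz, fun a haz hxa hya => h ?_⟩
    have ha := hW.left_mem hG haz hx hxa hz right_notMem_side
    have : x ∈ reachSet G (W \ {z}) a := hW.reachSet_diff hG ha haz ▸ ⟨hx, hxa⟩
    rw [reachSet_eq_of_mem this, hW.reachSet_diff hG ha haz]
    exact ⟨hy, hya⟩
  · rintro ⟨hx, hy, hz, h⟩
    refine ⟨hx, hy, hz, fun hmem => ?_⟩
    have hxz : x ≠ z := by
      obtain ⟨h, _⟩ := hmem
      exact h.2
    obtain ⟨a, ha, haz, hxa⟩ := hW.exists_adj_mem_side hz hx hxz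
    have : x ∈ reachSet G (W \ {z}) a := hW.reachSet_diff hG ha haz ▸ ⟨hx, hxa⟩
    rw [reachSet_eq_of_mem this, hW.reachSet_diff hG ha haz] at hmem
    exact h a haz hxa hmem.2

/-- If an edge separates `x` and `y` then both endpoints lie on the path from `x` to `y`. -/
lemma IsSubtree.onPath_of_mem_side (hG : G.IsTree) (hW : IsSubtree G W) (hab : G.Adj a b)
    (hx : x ∈ W) (hxs : x ∈ side G a b) (hy : y ∈ W) (hys : y ∉ side G a b) :
    OnPath G W x y a ∧ OnPath G W x y b := by
  have hys' := mem_side_swap hG hab hys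
  have hxs' := notMem_side_swap hG hab hxs
  rw [hW.onPath_iff hG, hW.onPath_iff hG]
  refine ⟨⟨hx, hy, hW.left_mem hG hab hx hxs hy hys, fun c hc hxc hyc => ?_⟩,
    hx, hy, hW.left_mem hG hab.symm hy hys' hx hxs', fun c hc hxc hyc => ?_⟩
  · exact hxs' (eq_of_mem_side_of_mem_side hG hab.symm hc hys' hyc ▸ hxc)
  · exact hys (eq_of_mem_side_of_mem_side hG hab hc hxs hxc ▸ hyc)

/-- Any three vertices of a subtree have a median. -/
lemma IsSubtree.exists_median [Finite V] (hG : G.IsTree) (hW : IsSubtree G W)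
    (hx : x ∈ W) (hy : y ∈ W) (hz : z ∈ W) :
    ∃ m, OnPath G W x z m ∧ OnPath G W y z m ∧ OnPath G W x y m := by
  by_cases hex : ∃ e : V × V, G.Adj e.1 e.2 ∧ x ∈ side G e.1 e.2 ∧ y ∈ side G e.1 e.2 ∧
      z ∉ side G e.1 e.2
  · obtain ⟨⟨a, b⟩, ⟨hab, hxs, hys, hzs⟩, hmin⟩ :=
      WellFounded.has_min (measure fun e : V × V => (side G e.1 e.2).ncard).wf
        {e | G.Adj e.1 e.2 ∧ x ∈ side G e.1 e.2 ∧ y ∈ side G e.1 e.2 ∧ z ∉ side G e.1 e.2} hex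
    dsimp only at hab hxs hys hzs
    have hxp := (hW.onPath_of_mem_side hG hab hx hxs hz hzs).1
    refine ⟨a, hxp, (hW.onPath_of_mem_side hG hab hy hys hz hzs).1, ?_⟩
    rw [hW.onPath_iff hG] at hxp ⊢
    refine ⟨hx, hy, hxp.2.2.1, fun c hc hxc hyc => ?_⟩
    have hcb : c ≠ b := by
      rintro rfl
      exact notMem_side_swap hG hab hxs hxc
    have hsub := side_subset_side_of_adj hG hc hab hcb
    refine hmin (c, a) ⟨hc, hxc, hyc, fun h => hzs (hsub h)⟩ ?_
    exact Set.ncard_lt_ncard ⟨hsub, fun h => right_notMem_side (h (left_mem_side hab))⟩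
      (Set.toFinite _)
  · refine ⟨z, ?_, ?_, ?_⟩
    all_goals
      rw [hW.onPath_iff hG]
    · exact ⟨hx, hz, hz, fun _ _ _ => right_notMem_side⟩
    · exact ⟨hy, hz, hz, fun _ _ _ => right_notMem_side⟩
    · exact ⟨hx, hy, hz, fun a ha hxa hya => hex ⟨(a, z), ha, hxa, hya, right_notMem_side⟩⟩

end Side

section Cost

variable {G : SimpleGraph V} {f : Set V → V → ℝ≥0∞} {W : Set V} {a b c d : V}

/-- Path monotonicity along a path: moving the sink away from a branch and enlarging the set
does not decrease the cost. -/
lemma IsMinmaxMonotone.le_of_notMem_side [Finite V] (hG : G.IsTree) (hf : IsMinmaxMonotone G f)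
    {A : Set V} (hA : IsSubtree G A) (ha : a ∈ A) (hc : c ∈ A) (hd : d ∈ A) (hcd : G.Adj c d)
    (hac : a ∉ side G c d) :
    f ((A ∩ side G c d) ∪ {d}) d ≤ f A a := by
  induction hn : A.ncard using Nat.strong_induction_on generalizing A a with
  | _ n ih =>
  subst hn
  by_cases had : a = d
  · subst had
    refine hf.set_mono _ _ _ ?_ hA (Or.inr rfl) ?_
    · exact (hA.inter_side hG hc hcd).union_singleton_s18 ⟨hc, left_mem_side hcd⟩ hcd
    · exact union_subset inter_subset_left (singleton_subset_iff.2 ha)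
  · obtain ⟨e, he, hea, hde⟩ := hA.exists_adj_mem_side ha hd (Ne.symm had)
    have hca : c ≠ a := fun h => hac (h ▸ left_mem_side hcd)
    have hce : c ∈ side G e a := mem_side_of_adj hde hcd.symm hca
    have hsub : side G c d ⊆ side G e a := side_subset_side (left_mem_side hcd) hce hac
    have hA' := hA.inter_side hG he hea
    have hecd : e ∉ side G c d := fun h => hac (mem_side_of_adj h hea had)
    have haA' : a ∉ A ∩ side G e a := fun h => right_notMem_side h.2
    have hlt : (A ∩ side G e a).ncard < A.ncard :=
      Set.ncard_lt_ncard ⟨inter_subset_left, fun h => haA' (h ha)⟩ (Set.toFinite _)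
    have heA' : e ∈ A ∩ side G e a := ⟨he, left_mem_side hea⟩
    have h1 := ih _ hlt hA' heA' ⟨hc, hce⟩ ⟨hd, hde⟩ hecd rfl
    rw [inter_assoc, inter_eq_right.2 hsub] at h1
    refine h1.trans ((hf.path_mono _ _ _ hA' haA' heA' hea.symm).trans ?_)
    refine hf.set_mono _ _ _ (hA'.union_singleton_s18 heA' hea) hA (Or.inr rfl) ?_
    exact union_subset inter_subset_left (singleton_subset_iff.2 ha)

/-- Cost comparison for nested branches of a subtree `W`. -/
lemma IsMinmaxMonotone.le_of_mem_side [Finite V] (hG : G.IsTree) (hf : IsMinmaxMonotone G f)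
    (hW : IsSubtree G W) (ha : a ∈ W) (hc : c ∈ W) (hd : d ∈ W) (hab : G.Adj a b)
    (hcd : G.Adj c d) (hsub : side G c d ⊆ side G a b) (hdab : d ∈ side G a b) :
    f ((W ∩ side G c d) ∪ {d}) d ≤ f (W ∩ side G a b) a := by
  have hac : a ∉ side G c d := by
    intro h
    by_cases hbd : b = d
    · exact right_notMem_side (hbd ▸ hdab)
    · exact right_notMem_side (hsub (mem_side_of_adj h hab hbd))
  have := hf.le_of_notMem_side hG (hW.inter_side hG ha hab) ⟨ha, left_mem_side hab⟩
    ⟨hc, hsub (left_mem_side hcd)⟩ ⟨hd, hdab⟩ hcd hac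
  rwa [inter_assoc, inter_eq_right.2 hsub] at this

/-- Max tree composition in terms of branches. -/
lemma IsMinmaxMonotone.le_of_branches_le (hG : G.IsTree) (hf : IsMinmaxMonotone G f) {A : Set V}
    (hA : IsSubtree G A) (ha : a ∈ A) {t : ℝ≥0∞}
    (h : ∀ e ∈ A, G.Adj e a → f ((A ∩ side G e a) ∪ {a}) a ≤ t) : f A a ≤ t := by
  rw [hf.max_comp A a hA ha]
  refine iSup₂_le fun z hz => ?_
  obtain ⟨e, he, hea, hze⟩ := hA.exists_adj_mem_side ha hz.1 hz.2
  have : z ∈ reachSet G (A \ {a}) e := hA.reachSet_diff hG he hea ▸ ⟨hz.1, hze⟩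
  rw [reachSet_eq_of_mem this, hA.reachSet_diff hG he hea]
  exact h e he hea

/-- An edge leading to a vertex outside a set `H` lies in a branch attached to `H`. -/
lemma IsSubtree.exists_branch [Finite V] (hG : G.IsTree) (hW : IsSubtree G W) {H : Set V} {v : V}
    (hv : v ∈ H) (hvW : v ∈ W) (ha : a ∈ W) (hb : b ∈ W) (hab : G.Adj a b) (hbH : b ∉ H)
    (hvab : v ∉ side G a b) :
    ∃ e ∈ W, ∃ w ∈ W, G.Adj e w ∧ e ∉ H ∧ w ∈ H ∧ side G a b ⊆ side G e w ∧ b ∈ side G e w := by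
  induction hn : (side G b a).ncard using Nat.strong_induction_on generalizing a b with
  | _ n ih =>
  subst hn
  obtain ⟨c, hc, hcb, hvc⟩ := hW.exists_adj_mem_side hb hvW fun h => hbH (h ▸ hv)
  have hac : a ≠ c := by
    rintro rfl
    exact hvab hvc
  have hsub := side_subset_side_of_adj hG hab hcb.symm hac
  by_cases hcH : c ∈ H
  · exact ⟨b, hb, c, hc, hcb.symm, hbH, hcH, hsub, left_mem_side hcb.symm⟩
  · have hlt : (side G c b).ncard < (side G b a).ncard :=
      Set.ncard_lt_ncard ⟨side_subset_side_of_adj hG hcb hab.symm hac.symm,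
        fun h => right_notMem_side (h (left_mem_side hab.symm))⟩ (Set.toFinite _)
    obtain ⟨e, he, w, hw, hew, heH, hwH, hs, hcs⟩ :=
      ih _ hlt hb hc hcb.symm hcH (notMem_side_swap hG hcb hvc) rfl
    exact ⟨e, he, w, hw, hew, heH, hwH, hsub.trans hs, hs (left_mem_side hcb.symm)⟩

/-- In an RC-viable tree a sink-free branch missing some hub-tree vertex has cost at most `𝒯`. -/
lemma RCViable.branch_le [Finite V] {𝒯 : ℝ≥0∞} {S : Set V} {r v : V} (hG : G.IsTree)
    (hf : IsMinmaxMonotone G f) (hW : IsSubtree G W) (hroot : GoodRoot G W S r)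
    (hRC : RCViable G f 𝒯 W S r) (hv : v ∈ hubVerts G W S r) (ha : a ∈ W) (hb : b ∈ W)
    (hab : G.Adj a b) (hvab : v ∉ side G a b) (hS : ∀ s ∈ S, s ∉ side G a b) :
    f ((W ∩ side G a b) ∪ {b}) b ≤ 𝒯 := by
  by_cases hbH : b ∈ hubVerts G W S r
  · by_cases haH : a ∈ hubVerts G W S r
    · exfalso
      obtain ⟨s, hs, hp⟩ := haH
      rw [hW.onPath_iff hG] at hp
      have hrab : r ∈ side G a b := mem_side_swap hG hab.symm
        (hp.2.2.2 b hab.symm (mem_side_swap hG hab (hS s hs)))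
      obtain ⟨hrW, -, c, d, hcd, hc, hd, hrc, hrd, ⟨s, hs, hsc⟩, t, ht, htd⟩ := hroot
      rw [hW.reachSet_diff hG hc hrc.symm] at hsc
      rw [hW.reachSet_diff hG hd hrd.symm] at htd
      have key : ∀ e, G.Adj r e → b ∉ side G e r → side G e r ⊆ side G a b := by
        intro e hre hbe
        refine side_subset_side (left_mem_side hre.symm) (mem_side_of_adj hrab hre ?_) hbe
        rintro rfl
        exact hbe (left_mem_side hre.symm)
      by_cases hbc : b ∈ side G c r
      · refine hS t ht (key d hrd (fun hbd => hcd ?_) htd.2)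
        exact eq_of_mem_side_of_mem_side hG hrc.symm hrd.symm hbc hbd
      · exact hS s hs (key c hrc hbc hsc.2)
    · have := hRC b hbH a ha hab.symm haH
      rwa [hW.reachSet_diff hG ha hab] at this
  · have hvW : v ∈ W := by
      obtain ⟨s, hs, hp⟩ := hv
      exact hp.2.2.1
    obtain ⟨e, he, w, hw, hew, heH, hwH, hsub, hbs⟩ :=
      hW.exists_branch hG hv hvW ha hb hab hbH hvab
    have h1 := hRC w hwH e he hew.symm heH
    rw [hW.reachSet_diff hG he hew] at h1
    refine (hf.le_of_mem_side hG hW he ha hb hew hab hsub hbs).trans (le_trans ?_ h1)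
    exact hf.path_mono _ _ _ (hW.inter_side hG he hew) (fun h => right_notMem_side h.2)
      ⟨he, left_mem_side hew⟩ hew.symm

/-- The peaking criterion in terms of sides of edges. -/
lemma IsSubtree.peakingPair_iff {𝒯 : ℝ≥0∞} {S : Set V} (hG : G.IsTree) (hW : IsSubtree G W)
    (hSW : S ⊆ W) :
    PeakingPair G f 𝒯 W S a b ↔ a ∈ W ∧ b ∈ W ∧ G.Adj a b ∧ (∀ s ∈ S, s ∉ side G a b) ∧
      f (W ∩ side G a b) a ≤ 𝒯 ∧ 𝒯 < f ((W ∩ side G a b) ∪ {b}) b := by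
  unfold PeakingPair
  refine and_congr_right fun ha => and_congr_right fun _ => and_congr_right fun hab => ?_
  rw [hW.reachSet_diff hG ha hab]
  refine and_congr_left fun _ => ?_
  rw [eq_empty_iff_forall_notMem]
  exact ⟨fun h s hs hsab => h s ⟨hs, hSW hs, hsab⟩, fun h s hs => h s hs.1 hs.2.2⟩

/-- Two peaking pairs whose branches share a vertex coincide, provided there is a sink. -/
lemma PeakingPair.unique [Finite V] {𝒯 : ℝ≥0∞} {S : Set V} {v : V} (hG : G.IsTree)
    (hf : IsMinmaxMonotone G f) (hW : IsSubtree G W) (hSW : S ⊆ W) (hS : S.Nonempty)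
    (h₁ : PeakingPair G f 𝒯 W S a b) (h₂ : PeakingPair G f 𝒯 W S c d)
    (hv₁ : v ∈ side G a b) (hv₂ : v ∈ side G c d) : a = c ∧ b = d := by
  rw [hW.peakingPair_iff hG hSW] at h₁ h₂
  obtain ⟨ha, hb, hab, hSab, hle₁, hlt₁⟩ := h₁
  obtain ⟨hc, hd, hcd, hScd, hle₂, hlt₂⟩ := h₂
  by_cases hbcd : b ∈ side G c d <;> by_cases hdab : d ∈ side G a b
  · obtain ⟨s, hs⟩ := hS
    have hsub : side G b a ⊆ side G c d :=
      side_subset_side (left_mem_side hab.symm) hbcd (notMem_side_swap hG hab hdab)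
    exact absurd (hsub (mem_side_swap hG hab (hSab s hs))) (hScd s hs)
  · have := hf.le_of_mem_side hG hW hc ha hb hcd hab (side_subset_side hv₁ hv₂ hdab) hbcd
    exact absurd (hlt₁.trans_le this) hle₂.not_gt
  · have := hf.le_of_mem_side hG hW ha hc hd hab hcd (side_subset_side hv₂ hv₁ hbcd) hdab
    exact absurd (hlt₂.trans_le this) hle₁.not_gt
  · have hcab : c ∈ side G a b := side_subset_side hv₂ hv₁ hbcd (left_mem_side hcd)
    have hdb : d = b := by
      by_contra hdb
      exact hdab (mem_side_of_adj hcab hcd hdb)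
    subst hdb
    exact ⟨eq_of_mem_side_of_mem_side hG hab hcd hv₁ hv₂, rfl⟩

end Cost

/-- hub-tree evolution, Case 1: after removing `V₋ᵥ(u)` for a reaching pair
`(u,v)`, if `v` is not a hub, `h` is the lowest hub strictly above `v`, `v'` is the child of
`h` whose subtree contains `v`, and `f(V̄₋ₕ(v') ∪ {h}, h) > 𝒯` in the new working tree `T̄`,
then some edge `(u', p(u'))` on the path `Π(v,h)` satisfies the peaking criterion in `T̄`,
and it is the unique edge of `T̄` satisfying the peaking criterion. -/
theorem statement_18 [Fintype V] (G : SimpleGraph V) (hG : G.IsTree)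
    (f : Set V → V → ℝ≥0∞) (hf : IsMinmaxMonotone G f) (𝒯 : ℝ≥0∞)
    (W S : Set V) (hW : IsSubtree G W) (hSW : S ⊆ W)
    (hSleaf : ∀ s ∈ S, IsLeafOf G W s)
    (r : V) (hS2 : 2 ≤ S.ncard) (hW2 : 2 < W.ncard) (hroot : GoodRoot G W S r)
    (hRC : RCViable G f 𝒯 W S r)
    (u v : V) (hreach : ReachingPair G f 𝒯 W S r u v)
    (hvnothub : ¬ IsHub G W S r v)
    (h : V) (hhub : IsHub G W S r h) (hne : h ≠ v) (honpath : OnPath G W v r h)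
    (hlowest : ∀ x : V, IsHub G W S r x → x ≠ v → OnPath G W v r x → OnPath G W v x h)
    (v' : V) (hv'W : v' ∈ W) (hv'adj : G.Adj h v')
    (hv'side : v ∈ reachSet G (W \ {h}) v')
    (hcost : 𝒯 < f (reachSet G ((W \ reachSet G (W \ {v}) u) \ {h}) v' ∪ {h}) h) :
    ∃ u' p' : V,
      OnPath G W v h u' ∧ OnPath G W v h p' ∧ G.Adj u' p' ∧ OnPath G W u' r p' ∧
      PeakingPair G f 𝒯 (W \ reachSet G (W \ {v}) u) (S \ reachSet G (W \ {v}) u) u' p' ∧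
      (∀ a b : V,
        PeakingPair G f 𝒯 (W \ reachSet G (W \ {v}) u) (S \ reachSet G (W \ {v}) u) a b →
        a = u' ∧ b = p') := by
  obtain ⟨⟨huH, hvH, huv, hpuv⟩, -, -⟩ := hreach
  have hvW : v ∈ W := hpuv.2.2.1
  have huW : u ∈ W := hpuv.1
  have hrW : r ∈ W := hpuv.2.1
  have hhW : h ∈ W := honpath.2.2.1
  obtain ⟨s₀, hs₀, hp₀⟩ := huH
  have hv'adj := hv'adj.symm
  rw [hW.reachSet_diff hG huW huv] at hcost ⊢
  rw [hW.reachSet_diff hG hv'W hv'adj] at hv'side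
  have hv's := hv'side.2
  have hruv : r ∉ side G u v :=
    ((hW.onPath_iff hG).1 hpuv).2.2.2 u huv (left_mem_side huv)
  have hrvu := mem_side_swap hG huv hruv
  have hrv'h : r ∉ side G v' h := ((hW.onPath_iff hG).1 honpath).2.2.2 v' hv'adj hv's
  have hs₀uv : s₀ ∈ side G u v := mem_side_swap hG huv.symm fun hs =>
    ((hW.onPath_iff hG).1 hp₀).2.2.2 v huv.symm hs hrvu
  have above : ∀ x e, G.Adj e x → v ∈ side G e x → r ∉ side G e x →
      x ∉ side G u v ∧ side G u v ⊆ side G e x := by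
    intro x e hex hve hre
    have hx : x ∉ side G u v := fun hx => hre
      (side_subset_side (left_mem_side huv.symm) hve (notMem_side_swap hG huv hx) hrvu)
    refine ⟨hx, side_subset_side (left_mem_side huv) (mem_side_of_adj hve huv.symm ?_) hx⟩
    rintro rfl
    exact hx (left_mem_side huv)
  obtain ⟨hhuv, huv_sub⟩ := above h v' hv'adj hv's hrv'h
  have hv'uv : v' ∉ side G u v := fun hh => hhuv (mem_side_of_adj hh hv'adj hne)
  have hW'eq : W \ (W ∩ side G u v) = W ∩ side G v u := by
    ext z
    constructor
    · exact fun hz => ⟨hz.1, mem_side_swap hG huv fun hh => hz.2 ⟨hz.1, hh⟩⟩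
    · exact fun hz => ⟨hz.1, fun hh => notMem_side_swap hG huv hh.2 hz.2⟩
  set W' := W \ (W ∩ side G u v) with hW'
  set S' := S \ (W ∩ side G u v) with hS'
  have hW't : IsSubtree G W' := hW'eq ▸ hW.inter_side hG hvW huv.symm
  have hS'W' : S' ⊆ W' := fun s hs => ⟨hSW hs.1, hs.2⟩
  have memW' : ∀ {z}, z ∈ W' ↔ z ∈ W ∧ z ∉ side G u v := by
    intro z
    rw [hW']
    simp only [mem_sdiff, mem_inter_iff]
    tauto
  have hhW' : h ∈ W' := memW'.2 ⟨hhW, hhuv⟩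
  have hv'W' : v' ∈ W' := memW'.2 ⟨hv'W, hv'uv⟩
  have hvW' : v ∈ W' := memW'.2 ⟨hvW, right_notMem_side⟩
  have hS'ne : S'.Nonempty := by
    obtain ⟨s₁, hs₁, s₂, hs₂, -, -, -, hp⟩ := hhub
    by_contra hemp
    have hall : ∀ s ∈ S, s ∈ side G v' h := fun s hs => huv_sub <| by
      by_contra hsu
      exact hemp ⟨s, hs, fun hh => hsu hh.2⟩
    exact ((hW.onPath_iff hG).1 hp).2.2.2 v' hv'adj (hall s₁ hs₁) (hall s₂ hs₂)
  have hsink : ∀ s ∈ S', s ∉ side G v' h := by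
    intro s hs hsv'
    have hsW := hSW hs.1
    have hsuv : s ∉ side G u v := fun hh => hs.2 ⟨hsW, hh⟩
    have hss₀ : s₀ ≠ s := fun hh => hsuv (hh ▸ hs₀uv)
    obtain ⟨m, hvm, hsm, hvsm⟩ := hW.exists_median hG hvW hsW hrW
    have hmv : m ≠ v := by
      rintro rfl
      exact hvnothub ⟨s₀, hs₀, s, hs.1, hss₀,
        (hW.onPath_of_mem_side hG huv (hSW hs₀) hs₀uv hrW hruv).2, hsm,
        (hW.onPath_of_mem_side hG huv (hSW hs₀) hs₀uv hsW hsuv).2⟩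
    obtain ⟨e, heW, hem, hve⟩ := hW.exists_adj_mem_side hvm.2.2.1 hvW hmv.symm
    have hre := ((hW.onPath_iff hG).1 hvm).2.2.2 e hem hve
    have hse := ((hW.onPath_iff hG).1 hvsm).2.2.2 e hem hve
    have hs₀e := (above m e hem hve hre).2 hs₀uv
    have hmh := hlowest m ⟨s₀, hs₀, s, hs.1, hss₀,
      (hW.onPath_of_mem_side hG hem (hSW hs₀) hs₀e hrW hre).2, hsm,
      (hW.onPath_of_mem_side hG hem (hSW hs₀) hs₀e hsW hse).2⟩ hmv hvm
    have hmv' := ((hW.onPath_iff hG).1 hmh).2.2.2 v' hv'adj hv's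
    exact hse (side_subset_side hv's hve hmv' hsv')
  have hbranch : ∀ a ∈ W', ∀ b ∈ W', G.Adj a b → v ∉ side G a b →
      (∀ s ∈ S', s ∉ side G a b) → f ((W' ∩ side G a b) ∪ {b}) b ≤ 𝒯 := by
    intro a ha b hb hab hvab hSab
    have hdisj : ∀ z ∈ side G a b, z ∉ side G u v := by
      intro z hz hzu
      have hua := side_subset_side hzu hz (memW'.1 hb).2 (left_mem_side huv)
      have hvb : v = b := by
        by_contra hvb
        exact hvab (mem_side_of_adj hua huv hvb)
      subst hvb
      have := eq_left_of_mem_side_of_adj hG hab hua huv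
      exact (memW'.1 ha).2 (this ▸ left_mem_side huv)
    have heq : W' ∩ side G a b = W ∩ side G a b := by
      ext z
      exact ⟨fun hz => ⟨hz.1.1, hz.2⟩, fun hz => ⟨memW'.2 ⟨hz.1, hdisj z hz.2⟩, hz.2⟩⟩
    rw [heq]
    refine hRC.branch_le hG hf hW hroot hvH ha.1 hb.1 hab hvab fun s hs hsab => ?_
    exact hSab s ⟨hs, fun hh => hdisj s hsab hh.2⟩ hsab
  rw [hW't.reachSet_diff hG hv'W' hv'adj] at hcost
  obtain ⟨⟨x, y⟩, ⟨hx, hy, hxy, hvxy, hsub, hlt⟩, hmin⟩ :=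
    WellFounded.has_min (measure fun e : V × V => (side G e.1 e.2).ncard).wf
      {e : V × V | e.1 ∈ W' ∧ e.2 ∈ W' ∧ G.Adj e.1 e.2 ∧ v ∈ side G e.1 e.2 ∧
        side G e.1 e.2 ⊆ side G v' h ∧ 𝒯 < f ((W' ∩ side G e.1 e.2) ∪ {e.2}) e.2}
      ⟨(v', h), hv'W', hhW', hv'adj, hv's, Subset.rfl, hcost⟩
  dsimp only at hx hy hxy hvxy hsub hlt
  have hxyS : ∀ s ∈ S', s ∉ side G x y := fun s hs hh => hsink s hs (hsub hh)
  have hle : f (W' ∩ side G x y) x ≤ 𝒯 := by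
    refine hf.le_of_branches_le hG (hW't.inter_side hG hx hxy) ⟨hx, left_mem_side hxy⟩ ?_
    intro e he hex
    have hey : e ≠ y := fun hh => right_notMem_side (hh ▸ he.2)
    have hesub := side_subset_side_of_adj hG hex hxy hey
    rw [inter_assoc, inter_eq_right.2 hesub]
    by_cases hve : v ∈ side G e x
    · by_contra hgt
      refine hmin (e, x) ⟨he.1, hx, hex, hve, hesub.trans hsub, not_le.1 hgt⟩ ?_
      exact Set.ncard_lt_ncard ⟨hesub, fun hh => right_notMem_side (hh (left_mem_side hxy))⟩
        (Set.toFinite _)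
    · exact hbranch e he.1 x hx hex hve fun s hs hh => hxyS s hs (hesub hh)
  have hpeak : PeakingPair G f 𝒯 W' S' x y :=
    (hW't.peakingPair_iff hG hS'W').2 ⟨hx, hy, hxy, hxyS, hle, hlt⟩
  have hpath := hW.onPath_of_mem_side hG hxy hvW hvxy hhW fun hh => right_notMem_side (hsub hh)
  refine ⟨x, y, hpath.1, hpath.2, hxy, ?_, hpeak, fun a b hab => ?_⟩
  · exact (hW.onPath_of_mem_side hG hxy hx.1 (left_mem_side hxy) hrW fun hh => hrv'h (hsub hh)).2
  · have hab' := (hW't.peakingPair_iff hG hS'W').1 hab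
    refine hab.unique hG hf hW't hS'W' hS'ne hpeak (v := v) ?_ hvxy
    by_contra hvab
    exact (hbranch a hab'.1 b hab'.2.1 hab'.2.2.1 hvab hab'.2.2.2.1).not_gt hab'.2.2.2.2.2
end
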